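/- Let A be a symmetric positive-definite n×n real matrix. Suppose B : (0,∞)^m → (0,∞) is twice differentiable, increasing in each variable, and there exists λ ≥ 0 such that D²B(x) ≤ λ·diag(∂₁B(x)/x₁, …, ∂_mB(x)/x_m) (as symmetric matrices) for all x ∈ (0,∞)^m. Let u₁,…,u_m : (0,∞) × ℝⁿ → (0,∞) be smooth with ∂_t u_j ≥ div(A⁻¹∇u_j) and D²(log u_j) ≥ −A/(2t) pointwise for all j. Then ũ(t,x) := t^{λn/2} B(u₁(t,x),…,u_m(t,x)) satisfies ∂_t ũ ≥ (1/(1+λ)) div(A⁻¹∇ũ) pointwise. Moreover, if Θ(x₁,…,x_m) := log B(e^{x₁},…,e^{x_m}) is convex, then (1/(1+λ)) D²(log ũ) ≥ −A/(2t) pointwise. -/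

import Mathlib

noncomputable section
open Real MeasureTheory Matrix Set

/-- Partial derivative of `f` in the `i`-th coordinate direction. -/
def pd {ι : Type*} [Fintype ι] [DecidableEq ι] (f : (ι → ℝ) → ℝ) (i : ι) (x : ι → ℝ) : ℝ :=
  fderiv ℝ f x (Pi.single i 1)

/-- Spatial gradient. -/
def grad' {ι : Type*} [Fintype ι] [DecidableEq ι] (f : (ι → ℝ) → ℝ) (x : ι → ℝ) : ι → ℝ :=
  fun i => pd f i x

/-- Spatial divergence of a vector field. -/
def div' {ι : Type*} [Fintype ι] [DecidableEq ι] (V : (ι → ℝ) → ι → ℝ) (x : ι → ℝ) : ℝ :=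
  ∑ i, pd (fun y => V y i) i x

/-- Hessian matrix. -/
def hess' {ι : Type*} [Fintype ι] [DecidableEq ι] (f : (ι → ℝ) → ℝ) (x : ι → ℝ) :
    Matrix ι ι ℝ :=
  Matrix.of fun i j => pd (fun y => pd f j y) i x

lemma fderiv_apply_eq_sum_pd {ι : Type*} [Fintype ι] [DecidableEq ι] (f : (ι → ℝ) → ℝ)
    (x v : ι → ℝ) : fderiv ℝ f x v = ∑ i, v i * pd f i x := by
  conv_lhs => rw [pi_eq_sum_univ' v, map_sum]
  simp [pd]

lemma pd_comp {ι κ : Type*} [Fintype ι] [DecidableEq ι] [Fintype κ] [DecidableEq κ]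
    {F : (κ → ℝ) → ℝ} {g : κ → (ι → ℝ) → ℝ} {x : ι → ℝ}
    (hF : DifferentiableAt ℝ F (fun j => g j x)) (hg : ∀ j, DifferentiableAt ℝ (g j) x) (i : ι) :
    pd (fun y => F (fun j => g j y)) i x = ∑ j, pd F j (fun j => g j x) * pd (g j) i x := by
  have hG : HasFDerivAt (fun y j => g j y) (ContinuousLinearMap.pi fun j => fderiv ℝ (g j) x) x :=
    hasFDerivAt_pi.2 fun j => (hg j).hasFDerivAt
  have h := hF.hasFDerivAt.comp x hG
  have h' : fderiv ℝ (fun y => F (fun j => g j y)) x = _ := h.fderiv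
  rw [pd, h', ContinuousLinearMap.comp_apply, fderiv_apply_eq_sum_pd]
  exact Finset.sum_congr rfl fun j _ => mul_comm _ _

lemma contDiffAt_pd {ι : Type*} [Fintype ι] [DecidableEq ι] {f : (ι → ℝ) → ℝ} {x : ι → ℝ}
    (hf : ContDiffAt ℝ 2 f x) (i : ι) : ContDiffAt ℝ 1 (pd f i) x :=
  (hf.fderiv_right (m := 1) (by norm_num)).clm_apply contDiffAt_const

lemma pd_congr {ι : Type*} [Fintype ι] [DecidableEq ι] {f g : (ι → ℝ) → ℝ} {x : ι → ℝ}
    (h : f =ᶠ[nhds x] g) (i : ι) : pd f i x = pd g i x := by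
  rw [pd, pd, h.fderiv_eq]

lemma pd_mul {ι : Type*} [Fintype ι] [DecidableEq ι] {f g : (ι → ℝ) → ℝ} {x : ι → ℝ}
    (hf : DifferentiableAt ℝ f x) (hg : DifferentiableAt ℝ g x) (i : ι) :
    pd (fun y => f y * g y) i x = pd f i x * g x + f x * pd g i x := by
  rw [pd, fderiv_fun_mul hf hg]
  simp [pd]
  ring

lemma pd_sum {ι κ : Type*} [Fintype ι] [DecidableEq ι] {s : Finset κ} {f : κ → (ι → ℝ) → ℝ}
    {x : ι → ℝ} (hf : ∀ j ∈ s, DifferentiableAt ℝ (f j) x) (i : ι) :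
    pd (fun y => ∑ j ∈ s, f j y) i x = ∑ j ∈ s, pd (f j) i x := by
  rw [pd, fderiv_fun_sum hf]
  simp [pd]

lemma pd_const_mul {ι : Type*} [Fintype ι] [DecidableEq ι] {f : (ι → ℝ) → ℝ} {x : ι → ℝ}
    (hf : DifferentiableAt ℝ f x) (c : ℝ) (i : ι) :
    pd (fun y => c * f y) i x = c * pd f i x := by
  rw [pd, fderiv_const_mul hf]
  simp [pd]

lemma hess'_apply {ι : Type*} [Fintype ι] [DecidableEq ι] (f : (ι → ℝ) → ℝ) (x : ι → ℝ)
    (i j : ι) : hess' f x i j = pd (pd f j) i x := rfl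

lemma hess'_const_mul {ι : Type*} [Fintype ι] [DecidableEq ι] {f : (ι → ℝ) → ℝ} {x : ι → ℝ}
    (hf : ContDiffAt ℝ 2 f x) (c : ℝ) : hess' (fun y => c * f y) x = c • hess' f x := by
  ext i j
  have h : (pd (fun y => c * f y) j) =ᶠ[nhds x] fun y => c * pd f j y := by
    filter_upwards [hf.eventually (by simp)] with y hy
    exact pd_const_mul (hy.differentiableAt (by simp)) c j
  simp only [hess'_apply, Matrix.smul_apply, smul_eq_mul]
  rw [pd_congr h, pd_const_mul ((contDiffAt_pd hf j).differentiableAt (by simp))]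

lemma hess'_const_add {ι : Type*} [Fintype ι] [DecidableEq ι] (f : (ι → ℝ) → ℝ) (x : ι → ℝ)
    (c : ℝ) : hess' (fun y => c + f y) x = hess' f x := by
  ext i j
  simp [hess', pd, fderiv_const_add]

lemma hess'_comp {ι κ : Type*} [Fintype ι] [DecidableEq ι] [Fintype κ] [DecidableEq κ]
    {F : (κ → ℝ) → ℝ} {g : κ → (ι → ℝ) → ℝ} {x : ι → ℝ}
    (hF : ContDiffAt ℝ 2 F (fun j => g j x)) (hg : ∀ j, ContDiffAt ℝ 2 (g j) x) :
    hess' (fun y => F (fun j => g j y)) x =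
      (∑ j, pd F j (fun j => g j x) • hess' (g j) x) +
        (of fun j i => pd (g j) i x)ᵀ * hess' F (fun j => g j x) * of fun j i => pd (g j) i x := by
  have hG : ContDiffAt ℝ 2 (fun y j => g j y) x := contDiffAt_pi.2 hg
  ext i k
  have h : (pd (fun y => F (fun j => g j y)) k) =ᶠ[nhds x]
      fun y => ∑ j, pd F j (fun j => g j y) * pd (g j) k y := by
    filter_upwards [hG.continuousAt.eventually (hF.eventually (by simp)),
      hG.eventually (by simp)] with y hy hy'
    exact pd_comp (hy.differentiableAt (by simp))
      (fun j => (contDiffAt_pi.1 hy' j).differentiableAt (by simp)) k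
  have hFj : ∀ j, DifferentiableAt ℝ (pd F j) (fun j => g j x) := fun j =>
    (contDiffAt_pd hF j).differentiableAt (by simp)
  have hgd : ∀ j, DifferentiableAt ℝ (g j) x := fun j => (hg j).differentiableAt (by simp)
  have hGd : DifferentiableAt ℝ (fun y j => g j y) x := hG.differentiableAt (by simp)
  have hFg : ∀ j, DifferentiableAt ℝ (fun y => pd F j (fun j => g j y)) x := fun j =>
    DifferentiableAt.comp (f := fun y j => g j y) x (hFj j) hGd
  have hgk : ∀ j, DifferentiableAt ℝ (pd (g j) k) x := fun j =>
    (contDiffAt_pd (hg j) k).differentiableAt (by simp)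
  simp only [hess'_apply, of_apply, Matrix.add_apply, Matrix.sum_apply, Matrix.smul_apply, smul_eq_mul, mul_apply,
    transpose_apply]
  rw [pd_congr h, pd_sum fun j _ => (hFg j).fun_mul (hgk j), ← Finset.sum_add_distrib]
  refine Finset.sum_congr rfl fun j _ => ?_
  rw [pd_mul (hFg j) (hgk j), pd_comp (hFj j) hgd, add_comm]
  congr 2
  exact Finset.sum_congr rfl fun l _ => mul_comm _ _

lemma pd_log {ι : Type*} [Fintype ι] [DecidableEq ι] {f : (ι → ℝ) → ℝ} {x : ι → ℝ}
    (hf : DifferentiableAt ℝ f x) (hx : f x ≠ 0) (i : ι) :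
    pd (fun y => Real.log (f y)) i x = (f x)⁻¹ * pd f i x := by
  rw [pd, fderiv.log hf hx]
  simp [pd]

/-- `∇f ⊗ ∇f` expressed through the Hessians of `f` and `log f`. -/
lemma vecMulVec_grad'_eq {ι : Type*} [Fintype ι] [DecidableEq ι] {f : (ι → ℝ) → ℝ} {x : ι → ℝ}
    (hf : ContDiffAt ℝ 2 f x) (hx : f x ≠ 0) :
    vecMulVec (grad' f x) (grad' f x) =
      f x • hess' f x - f x ^ 2 • hess' (fun y => Real.log (f y)) x := by
  ext i k
  have hfd := hf.differentiableAt (by simp)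
  have h : (pd (fun y => Real.log (f y)) k) =ᶠ[nhds x] fun y => (f y)⁻¹ * pd f k y := by
    filter_upwards [hf.eventually (by simp), hf.continuousAt.eventually_ne hx] with y hy hy'
    exact pd_log (hy.differentiableAt (by simp)) hy' k
  have hinv : pd (fun y => (f y)⁻¹) i x = -(f x ^ 2)⁻¹ * pd f i x := by
    have h' : fderiv ℝ (fun y => (f y)⁻¹) x = _ :=
      ((hasDerivAt_inv hx).comp_hasFDerivAt x hfd.hasFDerivAt).fderiv
    simp [pd, h']
  simp only [hess'_apply, vecMulVec_apply, grad', Matrix.sub_apply, Matrix.smul_apply, smul_eq_mul]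
  rw [pd_congr h, pd_mul (f := fun y => (f y)⁻¹) (hfd.inv hx) ((contDiffAt_pd hf k).differentiableAt (by simp)), hinv]
  field_simp
  ring

lemma isHermitian_hess' {ι : Type*} [Fintype ι] [DecidableEq ι] {f : (ι → ℝ) → ℝ} {x : ι → ℝ}
    (hf : ContDiffAt ℝ 2 f x) : (hess' f x).IsHermitian := by
  have hd : DifferentiableAt ℝ (fderiv ℝ f) x :=
    (hf.fderiv_right (m := 1) (by norm_num)).differentiableAt (by simp)
  have h : ∀ i j, hess' f x i j = fderiv ℝ (fderiv ℝ f) x (Pi.single i 1) (Pi.single j 1) := by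
    intro i j
    rw [hess'_apply]
    unfold pd
    rw [fderiv_clm_apply hd (differentiableAt_const _)]
    simp
  ext i j
  rw [conjTranspose_apply, star_trivial, h, h]
  exact hf.isSymmSndFDerivAt (by simp) _ _

lemma hasDerivAt_comp_sum_pd {ι : Type*} [Fintype ι] [DecidableEq ι] {f : (ι → ℝ) → ℝ}
    {g : ι → ℝ → ℝ} {g' : ι → ℝ} {s : ℝ} (hf : DifferentiableAt ℝ f (fun i => g i s))
    (hg : ∀ i, HasDerivAt (g i) (g' i) s) :
    HasDerivAt (fun r => f (fun i => g i r)) (∑ i, g' i * pd f i (fun i => g i s)) s := by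
  rw [← fderiv_apply_eq_sum_pd]
  exact hf.hasFDerivAt.comp_hasDerivAt (f := fun r i => g i r) s (hasDerivAt_pi.2 hg)

lemma hasDerivAt_sum_mul_pd {ι : Type*} [Fintype ι] [DecidableEq ι] {f : (ι → ℝ) → ℝ}
    {g : ι → ℝ → ℝ} {v : ι → ℝ} {s : ℝ} (hf : ContDiffAt ℝ 2 f (fun i => g i s))
    (hg : ∀ i, HasDerivAt (g i) (v i) s) :
    HasDerivAt (fun r => ∑ i, v i * pd f i (fun i => g i r))
      (v ⬝ᵥ hess' f (fun i => g i s) *ᵥ v) s := by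
  have h := HasDerivAt.fun_sum (u := Finset.univ) fun i _ => (hasDerivAt_comp_sum_pd
    ((contDiffAt_pd hf i).differentiableAt (by simp)) hg).const_mul (v i)
  refine h.congr_deriv ?_
  simp only [dotProduct, mulVec, Finset.mul_sum, hess'_apply]
  rw [Finset.sum_comm]
  exact Finset.sum_congr rfl fun i _ => Finset.sum_congr rfl fun j _ => by ring

lemma posSemidef_hess'_of_convexOn {ι : Type*} [Fintype ι] [DecidableEq ι] {f : (ι → ℝ) → ℝ}
    (hf : ContDiff ℝ 2 f) (hc : ConvexOn ℝ univ f) (x : ι → ℝ) : (hess' f x).PosSemidef := by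
  refine .of_dotProduct_mulVec_nonneg (isHermitian_hess' hf.contDiffAt) fun v => ?_
  have hg : ∀ s i, HasDerivAt (fun r => x i + r * v i) (v i) s := fun s i => by
    simpa using ((hasDerivAt_id s).mul_const (v i)).const_add (x i)
  have h1 : ∀ s, HasDerivAt (fun r => f (fun i => x i + r * v i))
      (∑ i, v i * pd f i (fun i => x i + s * v i)) s := fun s =>
    hasDerivAt_comp_sum_pd (g := fun i r => x i + r * v i)
      (hf.differentiable (by simp)).differentiableAt (hg s)
  have h2 := hasDerivAt_sum_mul_pd (g := fun i r => x i + r * v i) (s := 0)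
    (hf.contDiffAt (x := _)) (hg 0)
  have hconv : ConvexOn ℝ univ (fun r : ℝ => f (fun i => x i + r * v i)) := by
    have := hc.comp_affineMap (AffineMap.lineMap x (x + v))
    have heq : (fun r : ℝ => f (fun i => x i + r * v i)) = f ∘ AffineMap.lineMap x (x + v) := by
      ext r
      simp only [Function.comp, AffineMap.lineMap_apply]
      congr 1
      ext i
      simp [add_comm]
    rwa [heq]
  have hmono : Monotone (deriv fun r : ℝ => f (fun i => x i + r * v i)) :=
    monotoneOn_univ.1 (hconv.monotoneOn_deriv fun s _ => (h1 s).differentiableAt)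
  have hderiv : (deriv fun r : ℝ => f (fun i => x i + r * v i)) =
      fun s => ∑ i, v i * pd f i (fun i => x i + s * v i) := funext fun s => (h1 s).deriv
  have h3 := hmono.deriv_nonneg (x := 0)
  rw [hderiv, h2.deriv] at h3
  simpa using h3

lemma trace_mul_nonneg_of_posSemidef {ι : Type*} [Fintype ι] {P M : Matrix ι ι ℝ}
    (hP : P.PosSemidef) (hM : M.PosSemidef) : 0 ≤ (P * M).trace := by
  have h := (hP.hadamard hM).dotProduct_mulVec_nonneg 1
  simp only [star_trivial, dotProduct, mulVec, hadamard_apply, Pi.one_apply, one_mul,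
    mul_one] at h
  simp only [trace, diag, mul_apply]
  refine h.trans_eq (Finset.sum_congr rfl fun i _ => Finset.sum_congr rfl fun k _ => ?_)
  rw [← hM.1.apply k i, star_trivial]

/-- A positive function on the half-line with `s f'' ≤ λ f'` satisfies `s f' ≤ (1 + λ) f`. -/
lemma deriv_le_of_mul_second_deriv_le {f f' f'' : ℝ → ℝ} {lam : ℝ} (hlam : 0 ≤ lam)
    (hf : ∀ s > 0, HasDerivAt f (f' s) s) (hf' : ∀ s > 0, HasDerivAt f' (f'' s) s)
    (hpos : ∀ s > 0, 0 < f s) (h : ∀ s > 0, s * f'' s ≤ lam * f' s) :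
    f' 1 ≤ (1 + lam) * f 1 := by
  by_contra! hlt
  set c := f' 1 - (1 + lam) * f 1 with hc
  have hc0 : 0 < c := by linarith
  have hg : ∀ s > 0, HasDerivAt (fun s => s * f' s - (1 + lam) * f s)
      (1 * f' s + s * f'' s - (1 + lam) * f' s) s := fun s hs =>
    ((hasDerivAt_id s).mul (hf' s hs)).sub ((hf s hs).const_mul _)
  have hanti : AntitoneOn (fun s => s * f' s - (1 + lam) * f s) (Ioi 0) := by
    refine antitoneOn_of_deriv_nonpos (convex_Ioi 0)
      (fun s hs => (hg s hs).continuousAt.continuousWithinAt) ?_ ?_ <;> rw [interior_Ioi]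
    · exact fun s hs => (hg s hs).differentiableAt.differentiableWithinAt
    · intro s hs
      rw [(hg s hs).deriv]
      linarith [h s hs]
  have hk : ∀ s > 0, HasDerivAt (fun s => f s - c * Real.log s) (f' s - c * s⁻¹) s := fun s hs =>
    (hf s hs).sub ((Real.hasDerivAt_log hs.ne').const_mul c)
  have hmono : MonotoneOn (fun s => f s - c * Real.log s) (Ioc 0 1) := by
    refine monotoneOn_of_deriv_nonneg (convex_Ioc 0 1)
      (fun s hs => (hk s hs.1).continuousAt.continuousWithinAt) ?_ ?_ <;> rw [interior_Ioc]
    · exact fun s hs => (hk s hs.1).differentiableAt.differentiableWithinAt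
    · intro s hs
      rw [(hk s hs.1).deriv]
      have h1 := hanti (mem_Ioi.2 hs.1) (mem_Ioi.2 one_pos) hs.2.le
      have h2 : 0 ≤ (1 + lam) * f s := mul_nonneg (by linarith) (hpos s hs.1).le
      have h3 : c ≤ s * f' s := by simp only [one_mul] at h1; linarith
      rw [sub_nonneg, ← div_eq_mul_inv, div_le_iff₀ hs.1]
      linarith
  have h1 := hpos 1 one_pos
  have hle : Real.exp (-(f 1 / c)) ≤ 1 := Real.exp_le_one_iff.2 (by
    have := div_pos h1 hc0; linarith)
  have h2 := hmono ⟨Real.exp_pos _, hle⟩ ⟨one_pos, le_rfl⟩ hle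
  simp only [Real.log_exp, Real.log_one] at h2
  have h3 : c * -(f 1 / c) = -f 1 := by field_simp
  linarith [hpos _ (Real.exp_pos (-(f 1 / c)))]

/-- One-sided Euler inequality: a positive function on the orthant with
`D²B ≤ λ diag(∂_jB/x_j)` has degree of homogeneity at most `1 + λ`. -/
lemma sum_mul_pd_le {ι : Type*} [Fintype ι] [DecidableEq ι] {B : (ι → ℝ) → ℝ} {lam : ℝ}
    (hB : ∀ x, (∀ i, 0 < x i) → ContDiffAt ℝ 2 B x) (hB_pos : ∀ x, (∀ i, 0 < x i) → 0 < B x)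
    (hlam : 0 ≤ lam)
    (hB_hess : ∀ x, (∀ i, (0 : ℝ) < x i) →
      (lam • Matrix.diagonal (fun j => pd B j x / x j) - hess' B x).PosSemidef)
    {x : ι → ℝ} (hx : ∀ i, 0 < x i) : ∑ j, x j * pd B j x ≤ (1 + lam) * B x := by
  have hpos : ∀ s > (0 : ℝ), ∀ i, 0 < s * x i := fun s hs i => mul_pos hs (hx i)
  have hg : ∀ s i, HasDerivAt (fun r : ℝ => r * x i) (x i) s := fun s i => by
    simpa using (hasDerivAt_id s).mul_const (x i)
  have key := deriv_le_of_mul_second_deriv_le (f := fun s => B (fun i => s * x i)) hlam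
    (fun s hs => hasDerivAt_comp_sum_pd (g := fun i r => r * x i)
      ((hB _ (hpos s hs)).differentiableAt (by simp)) (hg s))
    (fun s hs => hasDerivAt_sum_mul_pd (g := fun i r => r * x i) (hB _ (hpos s hs)) (hg s))
    (fun s hs => hB_pos _ (hpos s hs)) ?_
  · simpa using key
  · intro s hs
    have h := (hB_hess _ (hpos s hs)).dotProduct_mulVec_nonneg x
    rw [star_trivial, sub_mulVec, dotProduct_sub, sub_nonneg, smul_mulVec, dotProduct_smul] at h
    refine (mul_le_mul_of_nonneg_left h hs.le).trans_eq ?_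
    simp only [smul_eq_mul, dotProduct, mulVec_diagonal,
      Finset.mul_sum]
    refine Finset.sum_congr rfl fun i _ => ?_
    have := (hx i).ne'
    have := hs.ne'
    field_simp

lemma div'_mulVec_grad' {ι : Type*} [Fintype ι] [DecidableEq ι] {f : (ι → ℝ) → ℝ} {x : ι → ℝ}
    {P : Matrix ι ι ℝ} (hP : P.IsHermitian) (hf : ContDiffAt ℝ 2 f x) :
    div' (fun y => P.mulVec (grad' f y)) x = (P * hess' f x).trace := by
  have hd : ∀ k, DifferentiableAt ℝ (pd f k) x := fun k =>
    (contDiffAt_pd hf k).differentiableAt (by simp)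
  simp only [div', mulVec, dotProduct, grad', trace, diag, mul_apply]
  rw [Finset.sum_comm]
  refine Finset.sum_congr rfl fun i _ => ?_
  rw [pd_sum fun k _ => (hd k).const_mul _]
  refine Finset.sum_congr rfl fun k _ => ?_
  rw [pd_const_mul (hd k)]
  simpa [hess'] using Or.inl (hP.apply i k).symm

lemma transpose_mul_diagonal_mul {ι κ : Type*} [Fintype κ] [DecidableEq κ] (d : κ → ℝ)
    (G : Matrix κ ι ℝ) : Gᵀ * diagonal d * G = ∑ j, d j • vecMulVec (G j) (G j) := by
  ext i k
  rw [mul_apply]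
  simp only [mul_diagonal, transpose_apply, Matrix.sum_apply, Matrix.smul_apply,
    vecMulVec_apply, smul_eq_mul]
  exact Finset.sum_congr rfl fun j _ => by ring

/-- The spatial part of the supersolution property of `B(u₁,…,u_m)`. -/
lemma trace_inv_mul_hess'_comp_le {ι κ : Type*} [Fintype ι] [DecidableEq ι] [Fintype κ]
    [DecidableEq κ] {A : Matrix ι ι ℝ} (hA : A.PosDef) {B : (κ → ℝ) → ℝ} {U : κ → (ι → ℝ) → ℝ}
    {x : ι → ℝ} {lam c : ℝ} (hlam : 0 ≤ lam) (hB : ContDiffAt ℝ 2 B (fun j => U j x))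
    (hB_mono : ∀ j, 0 ≤ pd B j (fun j => U j x))
    (hB_hess : (lam • Matrix.diagonal (fun j => pd B j (fun j => U j x) / U j x) -
      hess' B (fun j => U j x)).PosSemidef)
    (hU : ∀ j, ContDiffAt ℝ 2 (U j) x) (hU_pos : ∀ j, 0 < U j x)
    (hU_log : ∀ j, (hess' (fun y => Real.log (U j y)) x + c • A).PosSemidef) :
    (A⁻¹ * hess' (fun y => B (fun j => U j y)) x).trace ≤
      (1 + lam) * ∑ j, pd B j (fun j => U j x) * (A⁻¹ * hess' (U j) x).trace +
        lam * (c * Fintype.card ι) * ∑ j, U j x * pd B j (fun j => U j x) := by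
  have hP := hA.inv.posSemidef
  have hLog : ∀ j, -(c * Fintype.card ι) ≤
      (A⁻¹ * hess' (fun y => Real.log (U j y)) x).trace := fun j => by
    have h := trace_mul_nonneg_of_posSemidef hP (hU_log j)
    rw [mul_add, trace_add, Matrix.mul_smul, trace_smul, nonsing_inv_mul _ hA.det_pos.ne'.isUnit,
      trace_one, smul_eq_mul] at h
    linarith
  have hM := trace_mul_nonneg_of_posSemidef hP
    (hB_hess.conjTranspose_mul_mul_same (of fun j i => pd (U j) i x))
  rw [conjTranspose_eq_transpose_of_trivial, Matrix.mul_sub, Matrix.sub_mul, Matrix.mul_sub,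
    trace_sub, sub_nonneg, Matrix.mul_smul, Matrix.smul_mul, Matrix.mul_smul, trace_smul,
    transpose_mul_diagonal_mul, Finset.mul_sum, trace_sum, smul_eq_mul] at hM
  rw [hess'_comp hB hU, mul_add, trace_add, Finset.mul_sum, trace_sum]
  have hterm : ∀ j, (A⁻¹ * ((pd B j (fun j => U j x) / U j x) •
      vecMulVec (fun i => pd (U j) i x) (fun i => pd (U j) i x))).trace ≤
      pd B j (fun j => U j x) * (A⁻¹ * hess' (U j) x).trace +
        c * Fintype.card ι * (U j x * pd B j (fun j => U j x)) := fun j => by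
    have h := vecMulVec_grad'_eq (hU j) (hU_pos j).ne'
    change vecMulVec (fun i => pd (U j) i x) (fun i => pd (U j) i x) = _ at h
    rw [h, Matrix.mul_smul, Matrix.mul_sub, Matrix.mul_smul, Matrix.mul_smul, trace_smul,
      trace_sub, trace_smul, trace_smul]
    simp only [smul_eq_mul]
    have h1 := mul_le_mul_of_nonneg_left (hLog j) (mul_nonneg (hU_pos j).le (hB_mono j))
    have h2 := (hU_pos j).ne'
    calc _ = pd B j (fun j => U j x) * (A⁻¹ * hess' (U j) x).trace - U j x *
          pd B j (fun j => U j x) * (A⁻¹ * hess' (fun y => Real.log (U j y)) x).trace := by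
            field_simp
      _ ≤ _ := by linarith
  have hsum := mul_le_mul_of_nonneg_left
    (Finset.sum_le_sum fun j (_ : j ∈ Finset.univ) => hterm j) hlam
  rw [Finset.sum_add_distrib, ← Finset.mul_sum] at hsum
  simp only [Matrix.mul_smul, trace_smul, smul_eq_mul] at hsum hM ⊢
  change _ ≤ lam * ∑ j, pd B j (fun j => U j x) / U j x *
    (A⁻¹ * vecMulVec (fun i => pd (U j) i x) (fun i => pd (U j) i x)).trace at hM
  linarith

/-- The Li–Yau estimate for `log B(u₁,…,u_m)`, up to the Euler inequality for `B`. -/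
lemma posSemidef_hess'_log_comp {ι κ : Type*} [Fintype ι] [DecidableEq ι] [Fintype κ]
    [DecidableEq κ] {A : Matrix ι ι ℝ} (hA : A.PosSemidef) {B : (κ → ℝ) → ℝ}
    {U : κ → (ι → ℝ) → ℝ} {x : ι → ℝ} {lam c : ℝ} (hlam : 0 ≤ lam) (hc : 0 ≤ c)
    (hB : ∀ x, (∀ i, 0 < x i) → ContDiffAt ℝ 2 B x) (hB_pos : ∀ x, (∀ i, 0 < x i) → 0 < B x)
    (hB_mono : ∀ x, (∀ i, 0 < x i) → ∀ j, 0 ≤ pd B j x)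
    (hB_euler : ∑ j, U j x * pd B j (fun j => U j x) ≤ (1 + lam) * B (fun j => U j x))
    (hconv : ConvexOn ℝ univ (fun z : κ → ℝ => Real.log (B (fun i => Real.exp (z i)))))
    (hU : ∀ j, ContDiffAt ℝ 2 (U j) x) (hU_pos : ∀ j y, 0 < U j y)
    (hU_log : ∀ j, (hess' (fun y => Real.log (U j y)) x + c • A).PosSemidef) :
    ((1 / (1 + lam)) • hess' (fun y => Real.log (B (fun j => U j y))) x + c • A).PosSemidef := by
  set Θ : (κ → ℝ) → ℝ := fun z => Real.log (B (fun i => Real.exp (z i))) with hΘ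
  have hBe : ∀ z : κ → ℝ, 0 < B (fun i => Real.exp (z i)) := fun z =>
    hB_pos _ fun i => Real.exp_pos _
  have hexp : ∀ i, ContDiff ℝ 2 (fun z : κ → ℝ => Real.exp (z i)) := fun i =>
    (contDiff_apply ℝ ℝ i).exp
  have hΘs : ContDiff ℝ 2 Θ := contDiff_iff_contDiffAt.2 fun z =>
    ((hB _ fun i => Real.exp_pos _).comp (f := fun z : κ → ℝ => fun i => Real.exp (z i)) z
      (contDiff_pi.2 hexp).contDiffAt).log (hBe z).ne'
  set w : κ → (ι → ℝ) → ℝ := fun j y => Real.log (U j y) with hw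
  have hwexp : (fun j => Real.exp (w j x)) = fun j => U j x :=
    funext fun j => Real.exp_log (hU_pos j x)
  have hpd : ∀ j, pd Θ j (fun j => w j x) =
      (B (fun j => U j x))⁻¹ * (U j x * pd B j (fun j => U j x)) := fun j => by
    have hd : ∀ i, pd (fun z : κ → ℝ => Real.exp (z i)) j (fun j => w j x) =
        if i = j then U i x else 0 := fun i => by
      have h : HasFDerivAt (fun z : κ → ℝ => Real.exp (z i)) _ (fun j => w j x) :=
        (hasFDerivAt_apply i _).exp
      rw [pd, h.fderiv]
      simp [Pi.single_apply, congrFun hwexp i]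
    have hBd : DifferentiableAt ℝ B (fun j => Real.exp (w j x)) :=
      (hB _ fun i => Real.exp_pos _).differentiableAt (by simp)
    have hexpd : ∀ i, DifferentiableAt ℝ (fun z : κ → ℝ => Real.exp (z i)) (fun j => w j x) :=
      fun i => (hexp i).contDiffAt.differentiableAt (by simp)
    rw [hΘ, pd_log (f := fun z : κ → ℝ => B (fun i => Real.exp (z i))) (DifferentiableAt.comp (f := fun z : κ → ℝ => fun i => Real.exp (z i))
      (fun j => w j x) hBd (differentiableAt_pi.2 hexpd)) (hBe _).ne',
      pd_comp (g := fun i (z : κ → ℝ) => Real.exp (z i)) hBd hexpd, hwexp]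
    simp [hd, mul_comm]
  have hBU : 0 < B (fun j => U j x) := hB_pos _ fun j => hU_pos j x
  have hcomp : (fun y => Real.log (B (fun j => U j y))) = fun y => Θ (fun j => w j y) := by
    ext y
    simp only [hΘ, hw, Real.exp_log (hU_pos _ y)]
  have hpd_nonneg : ∀ j, 0 ≤ pd Θ j (fun j => w j x) := fun j => by
    rw [hpd]
    exact mul_nonneg (inv_nonneg.2 hBU.le)
      (mul_nonneg (hU_pos j x).le (hB_mono _ (fun j => hU_pos j x) j))
  have hpd_sum : ∑ j, pd Θ j (fun j => w j x) ≤ 1 + lam := by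
    simp only [hpd]
    rw [← Finset.mul_sum, inv_mul_le_iff₀ hBU]
    linarith
  have hlam' : 0 < 1 + lam := by linarith
  set G : Matrix κ ι ℝ := of fun j i => pd (w j) i x
  have hsplit : (1 / (1 + lam)) • hess' (fun y => Real.log (B (fun j => U j y))) x + c • A =
      (1 / (1 + lam)) • ((∑ j, pd Θ j (fun j => w j x) • (hess' (w j) x + c • A)) +
        Gᴴ * hess' Θ (fun j => w j x) * G +
        ((1 + lam - ∑ j, pd Θ j (fun j => w j x)) * c) • A) := by
    rw [hcomp, hess'_comp hΘs.contDiffAt fun j => (hU j).log (hU_pos j x).ne',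
      conjTranspose_eq_transpose_of_trivial]
    simp only [smul_add, Finset.sum_add_distrib, ← Finset.sum_smul, smul_smul]
    have : c • A = (1 / (1 + lam) * ((∑ j, pd Θ j (fun j => w j x)) * c)) • A +
        (1 / (1 + lam) * ((1 + lam - ∑ j, pd Θ j (fun j => w j x)) * c)) • A := by
      rw [← add_smul]
      congr 1
      field_simp
      ring
    simp only [← Finset.sum_mul]
    nth_rewrite 1 [this]
    abel
  rw [hsplit]
  refine .smul (.add (.add (posSemidef_sum _ fun j _ => (hU_log j).smul (hpd_nonneg j))
    ((posSemidef_hess'_of_convexOn hΘs hconv _).conjTranspose_mul_mul_same G))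
    (hA.smul (mul_nonneg (by linarith) hc))) (by positivity)

/-- Closure property for `B` with `D²B ≤ λ diag(∂_jB/x_j)`: for supersolutions satisfying
the Li–Yau estimate, `ũ = t^{λn/2} B(u₁,…,u_m)` is a supersolution of
`∂ₜu = (1+λ)⁻¹ div(A⁻¹∇u)`, and if `Θ` is convex then `(1+λ)⁻¹D²(log ũ) ≥ -A/(2t)`. -/
theorem general_concavity_closure
    {n m : ℕ} (A : Matrix (Fin n) (Fin n) ℝ) (hA : A.PosDef)
    (B : (Fin m → ℝ) → ℝ)
    (hB_smooth : ContDiffOn ℝ 2 B {x | ∀ i, 0 < x i})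
    (hB_pos : ∀ x, (∀ i, 0 < x i) → 0 < B x)
    (hB_mono : ∀ x, (∀ i, (0:ℝ) < x i) → ∀ j, 0 ≤ pd B j x)
    (lam : ℝ) (hlam : 0 ≤ lam)
    (hB_hess : ∀ x, (∀ i, (0:ℝ) < x i) →
      (lam • Matrix.diagonal (fun j => pd B j x / x j) - hess' B x).PosSemidef)
    (u : Fin m → ℝ → (Fin n → ℝ) → ℝ)
    (hu_smooth : ∀ j, ContDiffOn ℝ (⊤ : ℕ∞) (Function.uncurry (u j)) (Set.Ioi (0:ℝ) ×ˢ Set.univ))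
    (hu_pos : ∀ j, ∀ t > (0:ℝ), ∀ x, 0 < u j t x)
    (hu_super : ∀ j, ∀ t > (0:ℝ), ∀ x,
      deriv (fun s => u j s x) t ≥ div' (fun y => A⁻¹.mulVec (grad' (u j t) y)) x)
    (hu_LiYau : ∀ j, ∀ t > (0:ℝ), ∀ x,
      (hess' (fun y => Real.log (u j t y)) x + (1 / (2 * t)) • A).PosSemidef)
    (util : ℝ → (Fin n → ℝ) → ℝ)
    (hutil : util = fun t x => t ^ (lam * n / 2) * B (fun j => u j t x)) :
    (∀ t > (0:ℝ), ∀ x,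
      deriv (fun s => util s x) t
        ≥ (1 / (1 + lam)) * div' (fun y => A⁻¹.mulVec (grad' (util t) y)) x)
    ∧ (ConvexOn ℝ Set.univ
        (fun x : Fin m → ℝ => Real.log (B (fun i => Real.exp (x i)))) →
       ∀ t > (0:ℝ), ∀ x,
        ((1 / (1 + lam)) • hess' (fun y => Real.log (util t y)) x
          + (1 / (2 * t)) • A).PosSemidef) := by
  subst hutil
  have hopen : IsOpen {x : Fin m → ℝ | ∀ i, 0 < x i} := by
    simpa [Set.pi] using isOpen_set_pi (s := fun _ : Fin m => Ioi (0 : ℝ)) finite_univ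
      fun _ _ => isOpen_Ioi
  have hB : ∀ x, (∀ i, 0 < x i) → ContDiffAt ℝ 2 B x := fun x hx =>
    hB_smooth.contDiffAt (hopen.mem_nhds hx)
  have hu : ∀ j, ∀ t > (0 : ℝ), ∀ x, ContDiffAt ℝ 2 (Function.uncurry (u j)) (t, x) :=
    fun j t ht x => ((hu_smooth j).contDiffAt
      ((isOpen_Ioi.prod isOpen_univ).mem_nhds (mk_mem_prod (mem_Ioi.2 ht) (mem_univ x)))).of_le
        (WithTop.coe_le_coe.2 (le_top (a := (2 : ℕ∞))))
  have hux : ∀ j, ∀ t > (0 : ℝ), ∀ x, ContDiffAt ℝ 2 (u j t) x := fun j t ht x =>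
    (hu j t ht x).comp (f := fun y => (t, y)) x (contDiffAt_const.prodMk contDiffAt_id)
  have hut : ∀ j, ∀ t > (0 : ℝ), ∀ x, DifferentiableAt ℝ (fun s => u j s x) t := fun j t ht x =>
    ((hu j t ht x).comp (f := fun s => (s, x)) t
      (contDiffAt_id.prodMk contDiffAt_const)).differentiableAt (by simp)
  have heuler : ∀ t > (0 : ℝ), ∀ x, ∑ j, u j t x * pd B j (fun j => u j t x) ≤
      (1 + lam) * B (fun j => u j t x) := fun t ht x =>
    sum_mul_pd_le hB hB_pos hlam hB_hess fun j => hu_pos j t ht x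
  refine ⟨fun t ht x => ?_, fun hconv t ht x => ?_⟩
  · have hpos : ∀ j, 0 < u j t x := fun j => hu_pos j t ht x
    have hBU : ContDiffAt ℝ 2 (fun y => B (fun j => u j t y)) x :=
      (hB _ hpos).comp (f := fun y j => u j t y) x (contDiffAt_pi.2 fun j => hux j t ht x)
    have hderiv := (Real.hasDerivAt_rpow_const (p := lam * n / 2) (Or.inl ht.ne')).mul
      (hasDerivAt_comp_sum_pd (g := fun j s => u j s x) ((hB _ hpos).differentiableAt (by simp))
        fun j => (hut j t ht x).hasDerivAt)
    have hT := trace_inv_mul_hess'_comp_le hA (U := fun j => u j t) hlam (hB _ hpos)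
      (hB_mono _ hpos) (hB_hess _ hpos) (fun j => hux j t ht x) hpos
      (fun j => hu_LiYau j t ht x)
    have hS : ∑ j, pd B j (fun j => u j t x) * (A⁻¹ * hess' (u j t) x).trace ≤
        ∑ j, deriv (fun s => u j s x) t * pd B j (fun j => u j t x) :=
      Finset.sum_le_sum fun j _ => by
        rw [mul_comm, ← div'_mulVec_grad' hA.inv.1 (hux j t ht x)]
        exact mul_le_mul_of_nonneg_right (hu_super j t ht x) (hB_mono _ hpos j)
    have hE := mul_le_mul_of_nonneg_left (heuler t ht x)
      (by positivity : 0 ≤ lam * (1 / (2 * t) * Fintype.card (Fin n)))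
    have hlam' : 0 < 1 + lam := by linarith
    have hS' := mul_le_mul_of_nonneg_left hS hlam'.le
    have hd : deriv (fun s => s ^ (lam * n / 2) * B (fun j => u j s x)) t = _ := hderiv.deriv
    rw [hd, div'_mulVec_grad' hA.inv.1 (contDiffAt_const.mul hBU), hess'_const_mul hBU,
      Matrix.mul_smul, trace_smul, smul_eq_mul, Real.rpow_sub_one ht.ne', ge_iff_le, one_div,
      inv_mul_le_iff₀ hlam']
    simp only [Fintype.card_fin] at hT hE
    refine (mul_le_mul_of_nonneg_left (hT.trans (add_le_add hS' hE))
      (Real.rpow_nonneg ht.le _)).trans_eq ?_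
    field_simp
    ring
  · have hlog : (fun y => Real.log (t ^ (lam * n / 2) * B (fun j => u j t y))) =
        fun y => Real.log (t ^ (lam * n / 2)) + Real.log (B (fun j => u j t y)) := funext fun y =>
      Real.log_mul (Real.rpow_pos_of_pos ht _).ne' (hB_pos _ fun j => hu_pos j t ht y).ne'
    rw [hlog, hess'_const_add]
    exact posSemidef_hess'_log_comp hA.posSemidef hlam (by positivity) hB hB_pos hB_mono
      (heuler t ht x) hconv (fun j => hux j t ht x) (fun j y => hu_pos j t ht y)
      (fun j => hu_LiYau j t ht x)
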